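/- Fix P ∈ (0,1). There exists a constant C > 0, depending only on P, such that for all integers M ≥ K₀ ≥ 2 the following holds: let W ⊆ {0,1}^M be the set of words ω such that for every pair of indices 0 ≤ a < b ≤ M the frequency of the digit 0 among ω_{a+1},…,ω_b differs from P by less than K₀/(b−a). Then (1/M)·log|W| ≥ H(P) − C·(log K₀)/K₀ − C·K₀/M, where H(P) = −P log P − (1−P) log(1−P). -/

import Mathlib

open Real Filter Set

noncomputable section

/-- Binary entropy (with the convention `log 0 = 0`). -/
def Hbin (t : ℝ) : ℝ := -t * Real.log t - (1 - t) * Real.log (1 - t)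


lemma binom_mode (P : ℝ) (hP : P ∈ Set.Ioo (0 : ℝ) 1) (n : ℕ) :
    ∃ k ≤ n, (k = ⌊(n:ℝ) * P⌋₊ ∨ k = ⌊(n:ℝ) * P⌋₊ + 1) ∧
      1 ≤ ((n:ℝ) + 1) * (P ^ k * (1 - P) ^ (n - k) * (n.choose k : ℝ)) := by
  obtain ⟨h0, h1⟩ := hP
  have hq : 0 < 1 - P := by linarith
  set t : ℕ → ℝ := fun k => P ^ k * (1 - P) ^ (n - k) * (n.choose k : ℝ) with ht
  have hpos : ∀ k ≤ n, 0 < t k := by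
    intro k hk
    have : 0 < n.choose k := Nat.choose_pos hk
    simp only [ht]
    positivity
  have hrat : ∀ k, k + 1 ≤ n → t (k+1) * ((k + 1) * (1 - P)) = t k * ((n - k) * P) := by
    intro k hk
    have h := Nat.choose_succ_right_eq n k
    have h' : (n.choose (k+1) : ℝ) * (k+1) = n.choose k * (n - k) := by
      rw [← Nat.cast_sub (by omega : k ≤ n)]
      exact_mod_cast h
    have e : n - k = (n - (k+1)) + 1 := by omega
    simp only [ht]
    rw [e, pow_succ, pow_succ]
    linear_combination (P ^ k * P * (1 - P) ^ (n - (k+1)) * (1-P)) * h'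
  have hsum : ∑ k ∈ Finset.range (n+1), t k = 1 := by
    have := add_pow P (1-P) n
    rw [← this]; simp
  obtain ⟨k, hk, hmax⟩ := Finset.exists_max_image (Finset.range (n+1)) t ⟨0, by simp⟩
  have hkn : k ≤ n := by simpa [Nat.lt_succ_iff] using hk
  have hfl : (⌊(n:ℝ) * P⌋₊ : ℝ) ≤ n * P := Nat.floor_le (by positivity)
  have hfl2 : (n:ℝ) * P < ⌊(n:ℝ) * P⌋₊ + 1 := Nat.lt_floor_add_one _
  set m := ⌊(n:ℝ) * P⌋₊ with hm
  have hmn : m ≤ n := by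
    have : (m:ℝ) ≤ n := by nlinarith [(Nat.cast_nonneg n : (0:ℝ) ≤ n)]
    exact_mod_cast this
  refine ⟨k, hkn, ?_, ?_⟩
  · have hlow : m ≤ k := by
      by_contra! hc
      have a := hmax (k+1) (by simp; omega)
      have b := hrat k (by omega)
      have p := hpos k hkn
      have c : (k:ℝ) + 1 ≤ m := by exact_mod_cast hc
      have d : t k * ((n - k) * P) ≤ t k * ((k + 1) * (1 - P)) := by
        rw [← b]; gcongr
      have e := le_of_mul_le_mul_left d p
      nlinarith
    have hup : k ≤ m + 1 := by
      by_contra! hc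
      obtain ⟨i, rfl⟩ : ∃ i, k = i + 1 := ⟨k - 1, by omega⟩
      have a := hmax i (by simp; omega)
      have b := hrat i (by omega)
      have p := hpos (i+1) hkn
      have c : (m:ℝ) + 1 ≤ i := by exact_mod_cast (by omega : m + 1 ≤ i)
      have hni : (0:ℝ) ≤ (n:ℝ) - i := by
        have : (i:ℝ) ≤ n := by exact_mod_cast (by omega : i ≤ n)
        linarith
      have d : t (i+1) * ((i + 1) * (1 - P)) ≤ t (i+1) * ((n - i) * P) := by
        rw [b]; gcongr
      have e := le_of_mul_le_mul_left d p
      nlinarith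
    omega
  · have : ∑ j ∈ Finset.range (n+1), t j ≤ ∑ j ∈ Finset.range (n+1), t k :=
      Finset.sum_le_sum hmax
    rw [hsum] at this
    simpa using this

lemma binom_lower (P : ℝ) (hP : P ∈ Set.Ioo (0 : ℝ) 1) (n k : ℕ) (hn : 1 ≤ n)
    (hk : k = ⌊(n:ℝ) * P⌋₊ ∨ k = ⌊(n:ℝ) * P⌋₊ + 1) :
    (n:ℝ) * Hbin P - (-Real.log P - Real.log (1 - P)) - 2 * Real.log (n + 1)
      ≤ Real.log (n.choose k) ∧ 0 < n.choose k := by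
  obtain ⟨s, hsn, hs, hs1⟩ := binom_mode P hP n
  obtain ⟨h0, h1⟩ := hP
  have hq : 0 < 1 - P := by linarith
  have hn' : (1:ℝ) ≤ n := by exact_mod_cast hn
  have hfl : (⌊(n:ℝ) * P⌋₊ : ℝ) ≤ n * P := Nat.floor_le (by positivity)
  have hfl2 : (n:ℝ) * P < ⌊(n:ℝ) * P⌋₊ + 1 := Nat.lt_floor_add_one _
  set m := ⌊(n:ℝ) * P⌋₊ with hm
  have hmn : m < n := by
    have : (m:ℝ) < n := by nlinarith
    exact_mod_cast this
  have hkn : k ≤ n := by omega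
  have hcs : (0:ℝ) < n.choose s := by exact_mod_cast Nat.choose_pos hsn
  have hck : (0:ℝ) < n.choose k := by exact_mod_cast Nat.choose_pos hkn
  have hc : n.choose s ≤ (n+1) * n.choose k := by
    have h := Nat.choose_succ_right_eq n m
    have h2 : 1 ≤ n - m := by omega
    have h3 : n - m ≤ n + 1 := by omega
    have e1 : n.choose m ≤ (n+1) * n.choose (m+1) := by nlinarith
    have e2 : n.choose (m+1) ≤ (n+1) * n.choose m := by nlinarith [Nat.zero_le (n.choose (m+1) * m)]
    have e3 : ∀ x : ℕ, x ≤ (n+1) * x := fun x => by nlinarith [Nat.zero_le (n*x)]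
    rcases hs with rfl | rfl <;> rcases hk with rfl | rfl
    · exact e3 _
    · exact e1
    · exact e2
    · exact e3 _
  have hc' : (n.choose s : ℝ) ≤ ((n:ℝ)+1) * n.choose k := by exact_mod_cast hc
  have hl1 : Real.log (n.choose s) ≤ Real.log (n+1) + Real.log (n.choose k) := by
    rw [← Real.log_mul (by positivity) hck.ne']
    exact Real.log_le_log hcs hc'
  have hl2 : 0 ≤ Real.log (n+1) + (s * Real.log P + (n - s) * Real.log (1-P) + Real.log (n.choose s)) := by
    have := Real.log_nonneg hs1
    rw [Real.log_mul (by positivity) (by positivity), Real.log_mul (by positivity) (by positivity),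
      Real.log_mul (by positivity) (by positivity), Real.log_pow, Real.log_pow, Nat.cast_sub hsn] at this
    exact this
  have lp : Real.log P ≤ 0 := (Real.log_neg h0 h1).le
  have lq : Real.log (1-P) ≤ 0 := (Real.log_neg hq (by linarith)).le
  have s1 : (n:ℝ) * P - 1 ≤ s := by
    rcases hs with rfl | rfl <;> push_cast <;> linarith
  have s2 : (s:ℝ) ≤ n * P + 1 := by
    rcases hs with rfl | rfl <;> push_cast <;> linarith
  refine ⟨?_, Nat.choose_pos hkn⟩
  unfold Hbin
  nlinarith [mul_nonneg (sub_nonneg.2 s1) (neg_nonneg.2 lp), mul_nonneg (sub_nonneg.2 s2) (neg_nonneg.2 lq)]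

/-- The word built from the family of blocks. -/
def mkW (M n q : ℕ) (f : Fin q → Finset ℕ) : ℕ → Fin 2 := fun l =>
  if h : l / n < q then (if l % n ∈ f ⟨l / n, h⟩ then 0 else 1) else 1

lemma block_sum (n q : ℕ) (hn : 1 ≤ n) (F : ℕ → ℕ) (hF0 : F 0 = 0)
    (hF : ∀ j, F j ≤ F (j+1)) (M : ℕ) (f : Fin q → Finset ℕ)
    (hf : ∀ j : Fin q, f j ⊆ Finset.range n ∧ (f j).card = F (j+1) - F j) :
    ∀ j ≤ q, ∑ l ∈ Finset.range (j * n), (if mkW M n q f l = 0 then 1 else 0) = F j := by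
  intro j
  induction j with
  | zero => intro _; simp [hF0]
  | succ j ih =>
    intro hj
    have hjq : j < q := by omega
    rw [add_mul, one_mul, Finset.sum_range_add, ih (by omega)]
    have : ∑ i ∈ Finset.range n, (if mkW M n q f (j * n + i) = 0 then 1 else 0)
        = (f ⟨j, hjq⟩).card := by
      rw [← Finset.card_filter]
      congr 1
      ext i
      have hsub := (hf ⟨j, hjq⟩).1
      simp only [Finset.mem_filter, Finset.mem_range]
      constructor
      · rintro ⟨hi, h⟩
        have e1 : (j * n + i) / n = j := by
          rw [mul_comm, Nat.mul_add_div (by omega), Nat.div_eq_of_lt hi, add_zero]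
        have e2 : (j * n + i) % n = i := by
          rw [mul_comm, Nat.mul_add_mod, Nat.mod_eq_of_lt hi]
        simp only [mkW, e1, e2, hjq, dif_pos] at h
        by_contra hc
        simp [hc] at h
      · intro h
        have hi : i < n := by simpa using hsub h
        have e1 : (j * n + i) / n = j := by
          rw [mul_comm, Nat.mul_add_div (by omega), Nat.div_eq_of_lt hi, add_zero]
        have e2 : (j * n + i) % n = i := by
          rw [mul_comm, Nat.mul_add_mod, Nat.mod_eq_of_lt hi]
        refine ⟨hi, ?_⟩
        simp only [mkW, e1, e2, hjq, dif_pos]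
        simp [h]
    rw [this, (hf ⟨j, hjq⟩).2]
    have := hF j
    simp only
    omega

lemma mkW_inj (n q M : ℕ) (hM : q * n ≤ M) (f g : Fin q → Finset ℕ)
    (hf : ∀ j, f j ⊆ Finset.range n) (hg : ∀ j, g j ⊆ Finset.range n)
    (h : ∀ l < M, mkW M n q f l = mkW M n q g l) : f = g := by
  funext j
  ext i
  by_cases hi : i < n
  · have e1 : (j * n + i) / n = j := by
      rw [mul_comm, Nat.mul_add_div (by omega), Nat.div_eq_of_lt hi, add_zero]
    have e2 : (j * n + i) % n = i := by
      rw [mul_comm, Nat.mul_add_mod, Nat.mod_eq_of_lt hi]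
    have hl : j * n + i < M := by
      have : (j + 1) * n ≤ q * n := Nat.mul_le_mul_right _ j.2
      nlinarith
    have := h _ hl
    simp only [mkW, e1, e2, j.2, dif_pos] at this
    by_cases a : i ∈ f j <;> by_cases b : i ∈ g j <;> simp_all
  · exact ⟨fun h => absurd (by simpa using hf j h) hi, fun h => absurd (by simpa using hg j h) hi⟩

lemma card_seg (M a b : ℕ) (hab : a ≤ b) (hb : b ≤ M) (w : ℕ → Fin 2) :
    (((Finset.univ.filter
      (fun l : Fin M => a ≤ (l : ℕ) ∧ (l : ℕ) < b ∧ w l = 0)).card : ℕ) : ℝ)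
      = ((∑ l ∈ Finset.range b, (if w l = 0 then 1 else 0) : ℕ) : ℝ)
        - ((∑ l ∈ Finset.range a, (if w l = 0 then 1 else 0) : ℕ) : ℝ) := by
  rw [Finset.card_filter,
    Fin.sum_univ_eq_sum_range (fun l => if a ≤ l ∧ l < b ∧ w l = 0 then 1 else 0) M]
  rw [← Finset.sum_range_add_sum_Ico (fun l => if w l = 0 then 1 else 0) hab]
  push_cast
  rw [add_sub_cancel_left, ← Finset.sum_filter, ← Finset.sum_filter]
  congr 1
  ext l
  simp
  constructor
  · tauto
  · rintro ⟨⟨h1, h2⟩, h3⟩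
    exact ⟨by omega, h1, h2, h3⟩

lemma dev_bound (P : ℝ) (hP : P ∈ Set.Ioo (0 : ℝ) 1) (w : ℕ → Fin 2) (s i : ℕ) :
    |((∑ l ∈ Finset.range (s + i), (if w l = 0 then 1 else 0) : ℕ) : ℝ) - (s + i : ℕ) * P
      - (((∑ l ∈ Finset.range s, (if w l = 0 then 1 else 0) : ℕ) : ℝ) - s * P)| ≤ i := by
  obtain ⟨h0, h1⟩ := hP
  induction i with
  | zero => simp
  | succ i ih =>
    rw [← add_assoc, Finset.sum_range_succ]
    rw [abs_le] at ih ⊢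
    push_cast at ih ⊢
    split_ifs <;> constructor <;> nlinarith [ih.1, ih.2]

lemma count_lower (P : ℝ) (hP : P ∈ Set.Ioo (0 : ℝ) 1) (M K n : ℕ) (hn : 1 ≤ n)
    (hK : 2 * n + 1 ≤ K) :
    ((M / n : ℕ) : ℝ) * ((n:ℝ) * Hbin P - (-Real.log P - Real.log (1 - P)) - 2 * Real.log (n + 1))
      ≤ Real.log ((Set.ncard {ω : Fin M → Fin 2 |
          ∀ a b : ℕ, a < b → b ≤ M →
            |(((Finset.univ.filter
                  (fun l : Fin M => a ≤ (l : ℕ) ∧ (l : ℕ) < b ∧ ω l = 0)).card : ℝ)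
                / ((b : ℝ) - (a : ℝ)) - P)| < (K : ℝ) / ((b : ℝ) - (a : ℝ))} : ℝ)) := by
  set W := {ω : Fin M → Fin 2 |
          ∀ a b : ℕ, a < b → b ≤ M →
            |(((Finset.univ.filter
                  (fun l : Fin M => a ≤ (l : ℕ) ∧ (l : ℕ) < b ∧ ω l = 0)).card : ℝ)
                / ((b : ℝ) - (a : ℝ)) - P)| < (K : ℝ) / ((b : ℝ) - (a : ℝ))} with hW
  set q := M / n with hq
  have hP' := hP
  obtain ⟨h0, h1⟩ := hP
  let F : ℕ → ℕ := fun j => ⌊(j:ℝ) * (n * P)⌋₊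
  have hF0 : F 0 = 0 := by simp [F]
  have hF1 : ∀ j : ℕ, (F j : ℝ) ≤ j * (n * P) := fun j => Nat.floor_le (by positivity)
  have hF2 : ∀ j : ℕ, (j:ℝ) * (n * P) < F j + 1 := fun j => Nat.lt_floor_add_one _
  have hFd : ∀ j, F j + ⌊(n:ℝ) * P⌋₊ ≤ F (j+1) ∧ F (j+1) ≤ F j + ⌊(n:ℝ) * P⌋₊ + 1 := by
    intro j
    have a1 : (⌊(n:ℝ) * P⌋₊ : ℝ) ≤ n * P := Nat.floor_le (by positivity)
    have a2 : (n:ℝ) * P < ⌊(n:ℝ) * P⌋₊ + 1 := Nat.lt_floor_add_one _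
    have b1 := hF1 j
    have b2 := hF2 j
    have c1 := hF1 (j+1)
    have c2 := hF2 (j+1)
    push_cast at c1 c2
    constructor
    · have : ((F j + ⌊(n:ℝ) * P⌋₊ : ℕ) : ℝ) < (F (j+1) + 1 : ℕ) := by push_cast; nlinarith
      have := Nat.cast_lt.1 this
      omega
    · have : (F (j+1) : ℝ) < (F j + ⌊(n:ℝ) * P⌋₊ + 2 : ℕ) := by push_cast; nlinarith
      have := Nat.cast_lt.1 this
      omega
  have hqn : q * n ≤ M := Nat.div_mul_le_self M n
  let S : Finset (Fin q → Finset ℕ) :=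
    Fintype.piFinset (fun j : Fin q => Finset.powersetCard (F (j+1) - F j) (Finset.range n))
  have hS : ∀ f ∈ S, ∀ j : Fin q, f j ⊆ Finset.range n ∧ (f j).card = F (j+1) - F j := by
    intro f hf j
    have := Fintype.mem_piFinset.1 hf j
    simpa [Finset.mem_powersetCard] using this
  have hcard : (S.card : ℝ) = ∏ j : Fin q, (n.choose (F (j+1) - F j) : ℝ) := by
    simp [S, Fintype.card_piFinset, Finset.card_powersetCard]
  have hk : ∀ j : ℕ, F (j+1) - F j = ⌊(n:ℝ) * P⌋₊ ∨ F (j+1) - F j = ⌊(n:ℝ) * P⌋₊ + 1 := by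
    intro j; have := hFd j; omega
  have hlogS : (q:ℝ) * ((n:ℝ) * Hbin P - (-Real.log P - Real.log (1 - P)) - 2 * Real.log (n + 1))
      ≤ Real.log S.card := by
    rw [hcard, Real.log_prod]
    · calc _ = ∑ j : Fin q, ((n:ℝ) * Hbin P - (-Real.log P - Real.log (1 - P)) - 2 * Real.log (n + 1)) := by
            simp; ring
        _ ≤ _ := Finset.sum_le_sum (fun j _ => (binom_lower P hP' n _ hn (hk j)).1)
    · intro j _
      exact_mod_cast (binom_lower P hP' n _ hn (hk j)).2.ne'
  have hSpos : 0 < S.card := by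
    have : (0:ℝ) < S.card := by
      rw [hcard]
      exact Finset.prod_pos (fun j _ => by exact_mod_cast (binom_lower P hP' n _ hn (hk j)).2)
    exact_mod_cast this
  refine hlogS.trans (Real.log_le_log (by exact_mod_cast hSpos) ?_)
  have hle : (S : Set (Fin q → Finset ℕ)).ncard ≤ W.ncard := by
    refine Set.ncard_le_ncard_of_injOn (fun f => fun l : Fin M => mkW M n q f l) ?_ ?_ (Set.toFinite W)
    · intro f hf
      have hf' := hS f hf
      have hbs := block_sum n q hn F hF0 (fun j => by have := (hFd j).1; omega) M f hf'
      set w := mkW M n q f with hw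
      -- deviation bound at any point
      have hD : ∀ x ≤ M, -1 - (n:ℝ) < ((∑ l ∈ Finset.range x, (if w l = 0 then 1 else 0) : ℕ) : ℝ) - x * P
          ∧ ((∑ l ∈ Finset.range x, (if w l = 0 then 1 else 0) : ℕ) : ℝ) - x * P < n := by
        intro x hx
        have e : x / n * n + x % n = x := Nat.div_add_mod' x n
        have hlt : x % n < n := Nat.mod_lt _ (by omega)
        have hd := dev_bound P hP' w (x / n * n) (x % n)
        rw [e, hbs (x / n) (Nat.div_le_div_right hx)] at hd
        have b1 := hF1 (x / n)
        have b2 := hF2 (x / n)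
        have hlt' : ((x % n : ℕ) : ℝ) + 1 ≤ n := by exact_mod_cast hlt
        rw [abs_le] at hd
        obtain ⟨d1, d2⟩ := hd
        rw [Nat.cast_mul (x / n) n] at d1 d2
        constructor <;> nlinarith
      intro a b hab hb
      have hpos : (0:ℝ) < (b:ℝ) - a := by
        have : (a:ℝ) < b := by exact_mod_cast hab
        linarith
      have hc := card_seg M a b hab.le hb w
      simp only
      rw [hc]
      have ha := hD a (by omega)
      have hb' := hD b hb
      have hK' : 2 * (n:ℝ) + 1 ≤ K := by exact_mod_cast hK
      rw [div_sub' hpos.ne', abs_div, abs_of_pos hpos]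
      apply div_lt_div_of_pos_right _ hpos
      rw [abs_lt]
      constructor <;> nlinarith [ha.1, ha.2, hb'.1, hb'.2]
    · intro f hf g hg h
      refine mkW_inj n q M hqn f g (fun j => (hS f hf j).1) (fun j => (hS g hg j).1) ?_
      intro l hl
      exact congrFun h ⟨l, hl⟩
  rw [Set.ncard_coe_finset] at hle
  exact_mod_cast hle

/-- (Lemma 4.12) Counting words in `{0,1}^M` all of whose subwords
have digit-0 frequency within `K₀/(b-a)` of `P`. -/
theorem count_balanced_words (P : ℝ) (hP : P ∈ Set.Ioo (0 : ℝ) 1) :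
    ∃ C > (0 : ℝ), ∀ M K₀ : ℕ, 2 ≤ K₀ → K₀ ≤ M →
      Real.log ((Set.ncard {ω : Fin M → Fin 2 |
          ∀ a b : ℕ, a < b → b ≤ M →
            |(((Finset.univ.filter
                  (fun l : Fin M => a ≤ (l : ℕ) ∧ (l : ℕ) < b ∧ ω l = 0)).card : ℝ)
                / ((b : ℝ) - (a : ℝ)) - P)| < (K₀ : ℝ) / ((b : ℝ) - (a : ℝ))} : ℝ))
        / (M : ℝ)
      ≥ Hbin P - C * Real.log K₀ / K₀ - C * (K₀ : ℝ) / (M : ℝ) := by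
  have lp : Real.log P < 0 := Real.log_neg hP.1 hP.2
  have lq : Real.log (1-P) < 0 := Real.log_neg (by linarith [hP.2]) (by linarith [hP.1])
  have hH : 0 ≤ Hbin P := by
    unfold Hbin
    nlinarith [hP.1, hP.2, mul_pos hP.1 (neg_pos.2 lp), mul_pos (sub_pos.2 hP.2) (neg_pos.2 lq)]
  obtain ⟨c, hc⟩ : ∃ c, c = -Real.log P - Real.log (1 - P) := ⟨_, rfl⟩
  have hc0 : 0 < c := by linarith
  refine ⟨3 * Hbin P + 12 * c + 12, by positivity, ?_⟩
  intro M K hK hKM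
  have l2 := Real.log_two_gt_d9
  have hKr : (2:ℝ) ≤ K := by exact_mod_cast hK
  have hKMr : (K:ℝ) ≤ M := by exact_mod_cast hKM
  have hM0 : (0:ℝ) < M := by linarith
  have hlK : 0.69 < Real.log K := lt_of_lt_of_le (by linarith) (Real.log_le_log (by norm_num) hKr)
  rcases Nat.lt_or_ge K 3 with h3 | h3
  · have hK2 : K = 2 := by omega
    subst hK2
    have h1 : 0 ≤ (3 * Hbin P + 12 * c + 12) * ((2:ℕ) : ℝ) / (M : ℝ) := by positivity
    have h2 : Hbin P ≤ (3 * Hbin P + 12 * c + 12) * Real.log ((2:ℕ):ℝ) / ((2:ℕ):ℝ) := by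
      rw [le_div_iff₀ (by norm_num)]
      push_cast at hlK ⊢
      nlinarith
    refine le_trans (by linarith : _ ≤ (0:ℝ)) ?_
    exact div_nonneg (Real.log_natCast_nonneg _) hM0.le
  · obtain ⟨n, hn⟩ : ∃ n, n = (K - 1) / 2 := ⟨_, rfl⟩
    have hn1 : 1 ≤ n := by omega
    have hnK : 2 * n + 1 ≤ K := by omega
    have hnK2 : K ≤ 6 * n := by omega
    have key := count_lower P hP M K n hn1 hnK
    rw [← hc] at key
    refine ge_iff_le.2 ((le_div_iff₀ hM0).2 (le_trans ?_ key))
    have hn1r : (1:ℝ) ≤ n := by exact_mod_cast hn1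
    have hnKr : 2 * (n:ℝ) + 1 ≤ K := by exact_mod_cast hnK
    have hnK2r : (K:ℝ) ≤ 6 * n := by exact_mod_cast hnK2
    have hq1 : ((M / n : ℕ) : ℝ) * n ≤ M := by exact_mod_cast Nat.div_mul_le_self M n
    have hq2 : (M : ℝ) ≤ ((M / n : ℕ) : ℝ) * n + n := by
      have := Nat.div_add_mod' M n
      have h' := Nat.mod_lt M (by omega : n > 0)
      exact_mod_cast (by omega : M ≤ M / n * n + n)
    set q : ℝ := ((M / n : ℕ) : ℝ) with hq
    have hq0 : 0 ≤ q := Nat.cast_nonneg _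
    have hln : Real.log (n + 1) ≤ Real.log K := Real.log_le_log (by positivity) (by linarith)
    have hqK : q ≤ 6 * M / K := by
      rw [le_div_iff₀ (by linarith)]
      nlinarith
    have hE : c + 2 * Real.log (n+1) ≤ (2 * c + 2) * Real.log K := by nlinarith
    have h5 : q * (c + 2 * Real.log (n+1)) ≤ (6 * M / K) * ((2 * c + 2) * Real.log K) := by
      apply mul_le_mul hqK hE
      · have : 0 ≤ Real.log ((n:ℝ)+1) := Real.log_nonneg (by linarith)
        positivity
      · positivity
    have e : (Hbin P - (3 * Hbin P + 12 * c + 12) * Real.log K / K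
        - (3 * Hbin P + 12 * c + 12) * K / M) * M
        = M * Hbin P - (6 * M / K) * ((2 * c + 2) * Real.log K) - 3 * Hbin P * Real.log K / K * M
          - (3 * Hbin P + 12 * c + 12) * K := by
      field_simp
      ring
    rw [e]
    have h6 : 0 ≤ 3 * Hbin P * Real.log K / K * M := by positivity
    have h7 : M * Hbin P ≤ q * n * Hbin P + n * Hbin P := by nlinarith
    have h8 : n * Hbin P ≤ (3 * Hbin P + 12 * c + 12) * K := by
      have : (n:ℝ) * Hbin P ≤ K * Hbin P := by gcongr; linarith
      have : 0 ≤ K * Hbin P := by positivity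
      nlinarith
    linarith

end
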